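/- Let p ≥ 1 be an integer, let z, u ∈ ℂ^p satisfy z_p ≠ −1 and u_p ≠ −1, and let s ∈ ℂ. Put w = ψ₀(z) and v = ψ₀(u). Then (1 − Σ_{k=1}^{p} z_k·conj(u_k) − s)·(1+z_p)^{−1}·conj(1+u_p)^{−1} = (w_p − conj(v_p))/(2i) − Σ_{k=1}^{p−1} w_k·conj(v_k) − s·(1+z_p)^{−1}·conj(1+u_p)^{−1}. (This is the even-variable form of the paper's Lemma on the Cayley transform: the complex parameter s plays the role of the Grassmann quantity ξ·conj(η), and s·(1+z_p)^{−1}·conj(1+u_p)^{−1} plays the role of ω·conj(ζ), since ω_k = iξ_k/(1+z_p) and ζ_k = iη_k/(1+u_p).) -/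

import Mathlib

open Complex ComplexConjugate

/-- The Cayley transform `ψ₀` from the unit ball to the Siegel domain in `ℂ^(n+1)`:
`w_k = i z_k / (1 + z_p)` for `k < p` and `w_p = i (1 - z_p)/(1 + z_p)`, where `p = n+1`
is the last coordinate. -/
noncomputable def cayley (n : ℕ) (z : Fin (n + 1) → ℂ) : Fin (n + 1) → ℂ := fun k =>
  if k = Fin.last n then I * (1 - z (Fin.last n)) / (1 + z (Fin.last n))
  else I * z k / (1 + z (Fin.last n))

/-- Even-variable form of the Cayley-transform identity (Lemma on the super Cayley
transform): for `z, u` with `z_p ≠ -1`, `u_p ≠ -1`, `s ∈ ℂ`, `w = ψ₀(z)`, `v = ψ₀(u)`,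
`(1 - Σ z_k conj u_k - s) (1+z_p)⁻¹ conj(1+u_p)⁻¹
  = (w_p - conj v_p)/(2i) - Σ_{k<p} w_k conj v_k - s (1+z_p)⁻¹ conj(1+u_p)⁻¹`. -/
theorem cayley_identity (n : ℕ) (z u : Fin (n + 1) → ℂ)
    (hz : z (Fin.last n) ≠ -1) (hu : u (Fin.last n) ≠ -1) (s : ℂ) :
    (1 - (∑ k, z k * conj (u k)) - s) * (1 + z (Fin.last n))⁻¹ *
        conj ((1 + u (Fin.last n))⁻¹) =
      (cayley n z (Fin.last n) - conj (cayley n u (Fin.last n))) / (2 * I) -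
        (∑ k : Fin n, cayley n z k.castSucc * conj (cayley n u k.castSucc)) -
        s * (1 + z (Fin.last n))⁻¹ * conj ((1 + u (Fin.last n))⁻¹) := by
  have hz0 : 1 + z (Fin.last n) ≠ 0 := fun h => hz (by linear_combination h)
  have hu0 : 1 + u (Fin.last n) ≠ 0 := fun h => hu (by linear_combination h)
  have hub : 1 + conj (u (Fin.last n)) ≠ 0 := by
    intro h
    apply hu0
    have h2 := congrArg conj h
    simpa using h2
  have hsum : (∑ k : Fin n, cayley n z k.castSucc * conj (cayley n u k.castSucc)) =
      (∑ k : Fin n, z k.castSucc * conj (u k.castSucc)) *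
        ((1 + z (Fin.last n))⁻¹ * (1 + conj (u (Fin.last n)))⁻¹) := by
    rw [Finset.sum_mul]
    refine Finset.sum_congr rfl fun k _ => ?_
    have hk : k.castSucc ≠ Fin.last n := (Fin.castSucc_lt_last k).ne
    simp only [cayley, if_neg hk, map_div₀, map_mul, map_add, map_one, conj_I]
    field_simp
    linear_combination (-(z k.castSucc * conj (u k.castSucc))) * I_sq
  rw [hsum, Fin.sum_univ_castSucc]
  generalize (∑ k : Fin n, z k.castSucc * conj (u k.castSucc)) = S
  simp only [cayley, if_true, map_div₀, map_mul, map_add, map_sub, map_one, map_inv₀, conj_I]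
  generalize conj (u (Fin.last n)) = b at *
  generalize z (Fin.last n) = a at *
  have hI : I ≠ 0 := I_ne_zero
  field_simp
  ring
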